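/- Let H be a quaternion skew field with centre F, let g ∈ H∖{0} with g ∉ F·1, and let M be a 2-dimensional F-subspace of H with 1 ∈ M. Then the right parallel class {M·c : c ∈ H∖{0}} is invariant under left multiplication λ_g by g — equivalently, g·M = M·c for some c ∈ H∖{0} — if and only if M satisfies at least one of: (i) M = F·1 ⊕ F·g (the span of 1 and g), or (ii) tr(g·x) = 0 for all x ∈ M (i.e. F·1 ⊆ M ⊆ g⁻¹·(F1)^⊥). -/

import Mathlib

theorem aux_norm {F H : Type*} [Field F] [DivisionRing H] [Algebra F H] [StarRing H]
    (hcenter : ∀ z : H, z ∈ Subring.center H ↔ ∃ a : F, z = algebraMap F H a)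
    (tr : H → F)
    (htr : ∀ h : H, algebraMap F H (tr h) = h + star h) (h : H) :
    ∃ n : F, h * h - algebraMap F H (tr h) * h = algebraMap F H n := by
  rw [← hcenter, Subring.mem_center_iff]
  intro y
  have e1 : star h = algebraMap F H (tr h) - h := by rw [htr]; abel
  have e2 : star y = algebraMap F H (tr y) - y := by rw [htr]; abel
  have e3 : algebraMap F H (tr (h * y)) = h * y + star y * star h := by rw [htr, star_mul]
  rw [e1, e2] at e3
  have c1 := Algebra.commutes (tr h) y
  have c2 := Algebra.commutes (tr h) h
  have c3 := Algebra.commutes (tr y) h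
  have c4 := Algebra.commutes (tr (h * y)) h
  have c5 := Algebra.commutes (tr y) (algebraMap F H (tr h))
  generalize algebraMap F H (tr h) = t at *
  generalize algebraMap F H (tr y) = s at *
  generalize algebraMap F H (tr (h * y)) = u at *
  have k : h * (h * y + y * h) - (h * y + y * h) * h = h * (t * y) - (t * y) * h := by
    have : h * y + y * h = u - s * t + s * h + y * t := by rw [e3]; noncomm_ring
    rw [this]
    have d1 : h * (s * t) = s * t * h := by
      rw [← mul_assoc, ← c3, mul_assoc, mul_assoc, c2]
    have d2 : h * (s * h) = s * h * h := by rw [← mul_assoc, c3]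
    simp only [mul_add, add_mul, mul_sub, sub_mul, d1, d2, c4, c1]
    abel
  have d3 : h * (t * y) = t * h * y := by rw [← mul_assoc, c2]
  have d4 : t * y * h = y * (t * h) := by rw [c1, mul_assoc]
  rw [d3, d4] at k
  have k2 : h * (h * y + y * h) - (h * y + y * h) * h = h * h * y - y * (h * h) := by
    noncomm_ring
  rw [k2] at k
  rw [mul_sub, sub_mul]
  rw [sub_eq_iff_eq_add] at k
  rw [k]
  abel

/-- Let `H` be a quaternion skew field with centre `F`, let
`g ∈ H∖{0}` with `g ∉ F·1`, and let `M` be a line of `P(H_F)` (a `2`-dimensional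
`F`-subspace of `H`) with `1 ∈ M`.  Then the right parallel class
`{M·c : c ∈ H∖{0}}` is invariant under the left translation `λ_g` — that is,
`g·M = M·c` for some `c ∈ H∖{0}` — if and only if `M` satisfies at least one of:
(i) `M = F·1 ⊕ F·g`, the span of `1` and `g`; or
(ii) `tr (g·x) = 0` for all `x ∈ M` (i.e. `F·1 ⊆ M ⊆ g⁻¹·(F1)^⊥`). -/
theorem stmt_10 {F H : Type*} [Field F] [DivisionRing H] [Algebra F H] [StarRing H]
    (hrank : Module.finrank F H = 4)
    (hcenter : ∀ z : H, z ∈ Subring.center H ↔ ∃ a : F, z = algebraMap F H a)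
    (hstarF : ∀ a : F, star (algebraMap F H a) = algebraMap F H a)
    (tr : H → F)
    (htr : ∀ h : H, algebraMap F H (tr h) = h + star h)
    (g : H) (hg : g ≠ 0) (hgF : ∀ a : F, g ≠ algebraMap F H a)
    (M : Submodule F H) (hM : Module.finrank F M = 2) (h1M : (1 : H) ∈ M) :
    (∃ c : H, c ≠ 0 ∧
        (fun x => g * x) '' (M : Set H) = (fun x => x * c) '' (M : Set H)) ↔
      (M = Submodule.span F ({1, g} : Set H) ∨ ∀ x ∈ M, tr (g * x) = 0) := by
  have hnorm := aux_norm hcenter tr htr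
  have hfd : FiniteDimensional F H := Module.finite_of_finrank_pos (by omega)
  have hst : ∀ h : H, star h = algebraMap F H (tr h) - h := fun h => by rw [htr]; abel
  have hFM : ∀ a : F, algebraMap F H a ∈ M := fun a => by
    rw [Algebra.algebraMap_eq_smul_one]; exact M.smul_mem a h1M
  -- a non-scalar element of `M` generates `M`
  have hspan : ∀ m ∈ M, (∀ a : F, m ≠ algebraMap F H a) →
      Submodule.span F ({1, m} : Set H) = M := by
    intro m hm hmF
    apply Submodule.eq_of_le_of_finrank_eq
    · rw [Submodule.span_le]
      rintro x (rfl | rfl)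
      · exact h1M
      · exact hm
    · rw [hM]
      have li : LinearIndependent F ![(1 : H), m] := by
        rw [LinearIndependent.pair_iff' one_ne_zero]
        intro a ha
        exact hmF a (by rw [Algebra.algebraMap_eq_smul_one, ha])
      have := finrank_span_eq_card li
      have hr : Set.range ![(1 : H), m] = {1, m} := by
        ext x
        simp [eq_comm, or_comm]
      rw [hr] at this
      simpa using this
  obtain ⟨m, hm, hmF⟩ : ∃ m ∈ M, ∀ a : F, m ≠ algebraMap F H a := by
    by_contra! hcon
    have : M ≤ Submodule.span F {(1 : H)} := by
      intro x hx
      obtain ⟨a, rfl⟩ := hcon x hx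
      rw [Algebra.algebraMap_eq_smul_one]
      exact Submodule.smul_mem _ _ (Submodule.mem_span_singleton_self _)
    have := Submodule.finrank_mono this
    rw [hM, finrank_span_singleton one_ne_zero] at this
    omega
  have hform : ∀ x ∈ M, ∃ a b : F, x = algebraMap F H a + algebraMap F H b * m := by
    intro x hx
    rw [← hspan m hm hmF, Submodule.mem_span_pair] at hx
    obtain ⟨a, b, rfl⟩ := hx
    exact ⟨a, b, by rw [Algebra.algebraMap_eq_smul_one, ← Algebra.smul_def]⟩
  have hFmul : ∀ (a : F), ∀ x ∈ M, algebraMap F H a * x ∈ M := fun a x hx => by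
    rw [← Algebra.smul_def]; exact M.smul_mem a hx
  have hmm : m * m ∈ M := by
    obtain ⟨n, hn⟩ := hnorm m
    rw [sub_eq_iff_eq_add.mp hn]
    exact M.add_mem (hFM _) (hFmul _ _ hm)
  have hcomm : ∀ z : H, z * m = m * z → ∀ x ∈ M, z * x = x * z := by
    intro z hz x hx
    obtain ⟨a, b, rfl⟩ := hform x hx
    rw [mul_add, add_mul, ← Algebra.commutes a z, ← mul_assoc, ← Algebra.commutes b z,
      mul_assoc, hz, mul_assoc]
  have hmulm : ∀ x ∈ M, x * m ∈ M := by
    intro x hx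
    obtain ⟨a, b, rfl⟩ := hform x hx
    rw [add_mul, mul_assoc]
    exact M.add_mem (hFmul _ _ hm) (hFmul _ _ hmm)
  have hmul : ∀ x ∈ M, ∀ y ∈ M, x * y ∈ M := by
    intro x hx y hy
    obtain ⟨a, b, rfl⟩ := hform y hy
    rw [mul_add, ← Algebra.commutes a x, ← mul_assoc, ← Algebra.commutes b x, mul_assoc]
    exact M.add_mem (hFmul _ _ hx) (hFmul _ _ (hmulm x hx))
  have hMcomm : ∀ x ∈ M, x * m = m * x := fun x hx => (hcomm m rfl x hx).symm
  have hstM : ∀ x ∈ M, star x ∈ M := fun x hx => by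
    rw [hst]; exact M.sub_mem (hFM _) hx
  have hinv : ∀ x ∈ M, x⁻¹ ∈ M := by
    intro x hx
    by_cases hx0 : x = 0
    · simp [hx0]
    obtain ⟨n, hn⟩ := hnorm x
    by_cases hn0 : n = 0
    · rw [hn0, map_zero, ← sub_mul, mul_eq_zero, or_iff_left hx0, sub_eq_zero] at hn
      rw [hn, ← map_inv₀]
      exact hFM _
    · have : x⁻¹ = algebraMap F H n⁻¹ * (x - algebraMap F H (tr x)) := by
        apply inv_eq_of_mul_eq_one_left
        rw [mul_assoc, sub_mul, hn, ← map_mul, inv_mul_cancel₀ hn0, map_one]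
      rw [this]
      exact hFmul _ _ (M.sub_mem hx (hFM _))
  have hcent : ∀ z : H, z * m = m * z → z ∈ M := by
    intro z hz
    by_contra hzM
    let f : (M × M) →ₗ[F] H :=
      M.subtype.coprod ((LinearMap.mulRight F z).comp M.subtype)
    have hf : ∀ p : M × M, f p = p.1 + p.2 * z := fun p => by simp [f]
    have finj : Function.Injective f := by
      rw [← LinearMap.ker_eq_bot, LinearMap.ker_eq_bot']
      rintro ⟨⟨a, ha⟩, ⟨b, hb⟩⟩ hab
      rw [hf] at hab
      simp only at hab
      have hb0 : b = 0 := by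
        by_contra hb0
        apply hzM
        have : z = b⁻¹ * (-a) := by
          rw [eq_inv_mul_iff_mul_eq₀ hb0]
          exact (neg_eq_of_add_eq_zero_right hab).symm
        rw [this]
        exact hmul _ (hinv _ hb) _ (M.neg_mem ha)
      subst hb0
      simp at hab
      subst hab
      rfl
    have fsurj : Function.Surjective f :=
      (LinearMap.injective_iff_surjective_of_finrank_eq_finrank
        (by rw [Module.finrank_prod, hM, hrank])).mp finj
    have : m ∈ Subring.center H := by
      rw [Subring.mem_center_iff]
      intro h
      obtain ⟨⟨a, b⟩, rfl⟩ := fsurj h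
      rw [hf]
      rw [add_mul, mul_add, hMcomm _ a.2, mul_assoc, hz, ← mul_assoc, hMcomm _ b.2, mul_assoc]
    obtain ⟨a, ha⟩ := (hcenter m).mp this
    exact hmF a ha
  have hsm : star m * m = m * star m := hMcomm _ (hstM m hm)
  constructor
  · rintro ⟨c, hc, hE⟩
    obtain ⟨l, hl, hlg⟩ : g ∈ (fun x => x * c) '' (M : Set H) := by
      rw [← hE]; exact ⟨1, h1M, mul_one g⟩
    obtain ⟨w, hw, hwg⟩ : g * m ∈ (fun x => x * c) '' (M : Set H) := by
      rw [← hE]; exact ⟨m, hm, rfl⟩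
    simp only at hlg hwg
    have hl0 : l ≠ 0 := by rintro rfl; simp at hlg; exact hg hlg.symm
    obtain ⟨y, hy, hyg⟩ : ∃ y ∈ M, g * m = y * g := by
      refine ⟨w * l⁻¹, hmul _ hw _ (hinv _ hl), ?_⟩
      rw [← hwg, ← hlg, mul_assoc, inv_mul_cancel_left₀ hl0]
    have hprod : (y - m) * (y - star m) = 0 := by
      obtain ⟨n, hn⟩ := hnorm m
      have h1 : (y * y - algebraMap F H (tr m) * y - algebraMap F H n) * g = 0 := by
        have : (y * y - algebraMap F H (tr m) * y - algebraMap F H n) * g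
            = g * (m * m - algebraMap F H (tr m) * m - algebraMap F H n) := by
          simp only [sub_mul, mul_sub]
          rw [mul_assoc y y g, ← hyg, ← mul_assoc, ← hyg, mul_assoc, mul_assoc _ y g, ← hyg,
            ← mul_assoc g (algebraMap F H (tr m)), ← Algebra.commutes (tr m) g,
            Algebra.commutes n g, mul_assoc]
        rw [this, hn, sub_self, mul_zero]
      rw [mul_eq_zero, or_iff_left hg] at h1
      rw [← h1, ← hn, hst]
      simp only [sub_mul, mul_sub]
      rw [hMcomm y hy, Algebra.commutes (tr m) y, Algebra.commutes (tr m) m]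
      abel
    have key : g * m = m * g ∨ g * m = star m * g := by
      rcases mul_eq_zero.mp hprod with h | h
      · left; rw [hyg, sub_eq_zero.mp h]
      · right; rw [hyg, sub_eq_zero.mp h]
    by_cases hcm : g * m = m * g
    · left
      exact (hspan g (hcent g hcm) hgF).symm
    · right
      have hk := key.resolve_left hcm
      have hne : star m ≠ m := fun h => hcm (by rw [hk, h])
      have hk2 : star m * star g = star g * m := by
        have := congrArg star hk
        simpa using this
      have htg : algebraMap F H (tr g) = 0 := by
        by_contra h0
        apply hne
        rw [hst g, mul_sub, sub_mul, hk, sub_left_inj, ← Algebra.commutes] at hk2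
        exact mul_left_cancel₀ h0 hk2
      have hsg : star g = - g := by rw [hst, htg, zero_sub]
      intro x hx
      obtain ⟨a, b, rfl⟩ := hform x hx
      apply (algebraMap F H).injective
      rw [map_zero, htr, star_mul, star_add, star_mul, hstarF, hstarF, hsg]
      simp only [mul_add, add_mul, mul_neg]
      rw [mul_assoc (star m), Algebra.commutes b g, ← mul_assoc (star m), ← hk,
        Algebra.commutes a g, Algebra.commutes b m, mul_assoc]
      abel
  · have conv : ∀ φ : H → H, (∀ x ∈ M, φ x ∈ M) → (∀ x ∈ M, φ (φ x) = x) →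
        (∀ x ∈ M, g * x = φ x * g) → ∃ c : H, c ≠ 0 ∧
        (fun x => g * x) '' (M : Set H) = (fun x => x * c) '' (M : Set H) := by
      intro φ h1 h2 h3
      refine ⟨g, hg, ?_⟩
      ext z
      constructor
      · rintro ⟨x, hx, rfl⟩
        exact ⟨φ x, h1 x hx, (h3 x hx).symm⟩
      · rintro ⟨x, hx, rfl⟩
        refine ⟨φ x, h1 x hx, ?_⟩
        simp only
        rw [h3 _ (h1 x hx), h2 x hx]
    rintro (h | h)
    · have hgM : g ∈ M := by rw [h]; exact Submodule.subset_span (by simp)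
      exact conv id (fun x hx => hx) (fun x hx => rfl) (hcomm g (hMcomm g hgM))
    · refine conv star hstM (fun x _ => star_star x) ?_
      have hsg : star g = - g := by
        have := h 1 h1M
        rw [mul_one] at this
        rw [hst, this, map_zero, zero_sub]
      intro x hx
      have := htr (g * x)
      rw [h x hx, map_zero, star_mul, hsg, mul_neg, ← sub_eq_add_neg] at this
      exact sub_eq_zero.mp this.symm
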